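/- arXiv:2510.20094 — 2 statements merged into one kernel-verified Lean document; each statement's English description precedes it below -/
import Mathlib

section
/- Assume the resonance hypotheses: sup_{ℓ≥1} ℓ|a_ℓ| < ∞, and there are a > 0 and l, m ∈ ℕ≥1 with m < l and l ≠ 2m such that a_l = a_m = a_{l+m} = a and a_j < a for all j ∉ {l, m, l+m}. Then for every sign vector σ = (σ₁, σ₂, σ₃) with σ_i ∈ {−1, +1} and σ₁σ₂σ₃ = 1, there exist δ > 0, C > 0 and a map p^σ : (−δ,δ) → ℓ²_w, differentiable in s, such that for all s ∈ (−δ,δ): p^σ(s) solves the stationary Fourier system at κ(s) := (2/a)(1 − s); ‖p^σ(s) − s(σ₁ e_l + σ₂ e_m + σ₃ e_{l+m})‖_w ≤ C s²; and ‖(p^σ)′(s) − (σ₁ e_l + σ₂ e_m + σ₃ e_{l+m})‖_w ≤ C |s|. In particular these four bifurcating branches at κ = 2/a are transcritical (κ′(0) = −2/a ≠ 0). -/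
open scoped BigOperators
open Filter Topology Real

noncomputable section

/-- `x` solves the stationary Fourier system at intensity `κ` for coefficients `a`:
for every `ℓ ≥ 1` the tail series converges absolutely (equivalently, is `Summable` in `ℝ`) and
`ℓ(2 − κ a_ℓ) x_ℓ = κ ∑_{j=1}^{ℓ−1} j a_j x_j x_{ℓ−j}
  + κ ∑_{j=ℓ+1}^∞ (j a_j − (j−ℓ) a_{j−ℓ}) x_j x_{j−ℓ}`,
where the infinite sum is indexed by `j = ℓ + k + 1`, `k : ℕ`. -/
def SolvesMV (a : ℕ → ℝ) (κ : ℝ) (x : ℕ → ℝ) : Prop :=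
  ∀ ℓ : ℕ, 1 ≤ ℓ →
    Summable (fun k : ℕ =>
      (((ℓ + k + 1 : ℕ) : ℝ) * a (ℓ + k + 1) - ((k + 1 : ℕ) : ℝ) * a (k + 1))
        * x (ℓ + k + 1) * x (k + 1)) ∧
    (ℓ : ℝ) * (2 - κ * a ℓ) * x ℓ
      = κ * ∑ j ∈ Finset.Ico 1 ℓ, (j : ℝ) * a j * x j * x (ℓ - j)
        + κ * ∑' k : ℕ,
            (((ℓ + k + 1 : ℕ) : ℝ) * a (ℓ + k + 1) - ((k + 1 : ℕ) : ℝ) * a (k + 1))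
              * x (ℓ + k + 1) * x (k + 1)

/-- The squared weighted norm `∑_{ℓ≥1} (1+ℓ²) x_ℓ²`. -/
def wnormSq (x : ℕ → ℝ) : ℝ := ∑' ℓ : ℕ, (1 + ((ℓ + 1 : ℕ) : ℝ) ^ 2) * x (ℓ + 1) ^ 2

/-- The weighted norm `‖x‖_w = (∑_{ℓ≥1} (1+ℓ²) x_ℓ²)^{1/2}`. -/
def wnorm (x : ℕ → ℝ) : ℝ := Real.sqrt (wnormSq x)

/-- Membership in the weighted space `ℓ²_w`. -/
def MemL2w (x : ℕ → ℝ) : Prop :=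
  Summable fun ℓ : ℕ => (1 + ((ℓ + 1 : ℕ) : ℝ) ^ 2) * x (ℓ + 1) ^ 2


/-- The Banach space of absolutely summable real sequences. -/
abbrev L1 : Type := lp (fun _ : ℕ => ℝ) 1

lemma L1.summable_abs (h : L1) : Summable fun n => |h n| := by
  have := (lp.memℓp h).summable (by norm_num)
  simpa using this

lemma L1.norm_eq (h : L1) : ‖h‖ = ∑' n, |h n| := by
  rw [lp.norm_eq_tsum_rpow (by norm_num)]
  simp

/-- The basis vector of `L1`. -/
def bas (n : ℕ) : L1 := lp.single 1 n (1 : ℝ)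

lemma bas_apply (n k : ℕ) : (bas n : L1) k = if k = n then 1 else 0 := by
  simp only [bas, lp.single_apply, Pi.single_apply]

lemma norm_bas (n : ℕ) : ‖bas n‖ = 1 := by
  simp [bas]

/-- Coordinate functional. -/
def coord (n : ℕ) : L1 →L[ℝ] ℝ := lp.evalCLM ℝ (fun _ : ℕ => ℝ) 1 n

lemma coord_apply (n : ℕ) (h : L1) : coord n h = h n := rfl

section lift
variable {F : Type*} [NormedAddCommGroup F] [NormedSpace ℝ F] [CompleteSpace F]

set_option linter.unusedSectionVars false in
lemma lift_summable_norm (v : ℕ → F) (C : ℝ) (hv : ∀ n, ‖v n‖ ≤ C) (h : L1) :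
    Summable fun n => ‖h n • v n‖ := by
  refine Summable.of_nonneg_of_le (fun n => norm_nonneg _) (fun n => ?_)
    ((h.summable_abs).mul_right C)
  rw [norm_smul, Real.norm_eq_abs]
  exact mul_le_mul_of_nonneg_left (hv n) (abs_nonneg _)

/-- The continuous linear map on `L1` with prescribed bounded values on the basis. -/
def lift (v : ℕ → F) (C : ℝ) (hv : ∀ n, ‖v n‖ ≤ C) : L1 →L[ℝ] F :=
  LinearMap.mkContinuous
    { toFun := fun h => ∑' n, h n • v n
      map_add' := fun h g => by
        rw [← Summable.tsum_add (lift_summable_norm v C hv h).of_norm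
          (lift_summable_norm v C hv g).of_norm]
        exact tsum_congr fun n => by simp [add_smul]
      map_smul' := fun c h => by
        simp only [RingHom.id_apply]
        rw [← Summable.tsum_const_smul c (lift_summable_norm v C hv h).of_norm]
        exact tsum_congr fun n => by simp [mul_smul] } C
    (fun h => by
      have h1 := lift_summable_norm v C hv h
      refine (norm_tsum_le_tsum_norm h1).trans ?_
      rw [L1.norm_eq, ← tsum_mul_left]
      refine h1.tsum_le_tsum (fun n => ?_) ((h.summable_abs).mul_left C)
      rw [norm_smul, Real.norm_eq_abs, mul_comm]
      exact mul_le_mul_of_nonneg_right (hv n) (abs_nonneg _))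

lemma lift_hasSum (v : ℕ → F) (C : ℝ) (hv : ∀ n, ‖v n‖ ≤ C) (h : L1) :
    HasSum (fun n => h n • v n) (lift v C hv h) :=
  (lift_summable_norm v C hv h).of_norm.hasSum

lemma lift_bas (v : ℕ → F) (C : ℝ) (hv : ∀ n, ‖v n‖ ≤ C) (k : ℕ) :
    lift v C hv (bas k) = v k := by
  have h1 := lift_hasSum v C hv (bas k)
  have h2 : HasSum (fun n => (bas k) n • v n) ((bas k) k • v k) := by
    refine hasSum_single k (fun n hn => ?_)
    simp [bas_apply, hn]
  rw [h1.unique h2, bas_apply]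
  simp

lemma norm_lift_le (v : ℕ → F) (C : ℝ) (hC : 0 ≤ C) (hv : ∀ n, ‖v n‖ ≤ C) :
    ‖lift v C hv‖ ≤ C := LinearMap.mkContinuous_norm_le _ hC _
end lift

lemma mul_bound {f : ℕ → ℝ} {C : ℝ} (hf : ∀ n, |f n| ≤ C) (n : ℕ) : ‖f n • bas n‖ ≤ C := by
  rw [norm_smul, norm_bas, mul_one]
  exact hf n

/-- Multiplication by a bounded sequence. -/
def mulOp (f : ℕ → ℝ) (C : ℝ) (hf : ∀ n, |f n| ≤ C) : L1 →L[ℝ] L1 :=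
  lift (fun n => f n • bas n) C (mul_bound hf)

lemma mulOp_bas (f : ℕ → ℝ) (C : ℝ) (hf : ∀ n, |f n| ≤ C) (n : ℕ) :
    mulOp f C hf (bas n) = f n • bas n := lift_bas _ _ _ _

lemma mulOp_apply (f : ℕ → ℝ) (C : ℝ) (hf : ∀ n, |f n| ≤ C) (h : L1) (n : ℕ) :
    (mulOp f C hf h) n = f n * h n := by
  have h1 := (lift_hasSum (fun n => f n • bas n) C (mul_bound hf) h).mapL (coord n)
  have h2 : HasSum (fun k => coord n (h k • f k • bas k)) (coord n (h n • f n • bas n)) := by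
    refine hasSum_single n (fun k hk => ?_)
    simp [coord_apply, bas_apply, hk.symm]
  have h3 := h1.unique h2
  simp only [coord_apply] at h3
  rw [mulOp, h3]
  simp [bas_apply]
  ring

/-- Structure constants of the quadratic term. -/
def cst (b : ℕ → ℝ) (i j : ℕ) : L1 :=
  b i • bas (i + j) + (if j < i then b i - b j else 0) • bas (i - j)

lemma cst_bound {b : ℕ → ℝ} {A : ℝ} (hb : ∀ n, |b n| ≤ A) (i j : ℕ) : ‖cst b i j‖ ≤ 3 * A := by
  have h1 := hb i
  have h2 := hb j
  have h0 : 0 ≤ |b j| := abs_nonneg _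
  have h3 := abs_sub (b i) (b j)
  refine (norm_add_le _ _).trans ?_
  rw [norm_smul, norm_smul, norm_bas, norm_bas, Real.norm_eq_abs, Real.norm_eq_abs]
  split_ifs
  · linarith
  · simp only [abs_zero]; linarith

/-- The bilinear form. -/
def bil (b : ℕ → ℝ) (A : ℝ) (hA : 0 ≤ A) (hb : ∀ n, |b n| ≤ A) : L1 →L[ℝ] L1 →L[ℝ] L1 :=
  lift (fun i => lift (cst b i) (3 * A) (cst_bound hb i)) (3 * A)
    (fun i => norm_lift_le _ _ (by linarith) _)

lemma bil_bas (b : ℕ → ℝ) (A : ℝ) (hA : 0 ≤ A) (hb : ∀ n, |b n| ≤ A) (i j : ℕ) :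
    bil b A hA hb (bas i) (bas j) = cst b i j := by
  rw [bil, lift_bas, lift_bas]

lemma inner_apply (b : ℕ → ℝ) (A : ℝ) (hb : ∀ n, |b n| ≤ A) (i n : ℕ) (hn : 1 ≤ n) (z : L1)
    (hz : z 0 = 0) :
    (lift (cst b i) (3 * A) (cst_bound hb i) z) n =
      if i ≤ n then b i * z (n - i) else (b i - b (i - n)) * z (i - n) := by
  have h1 := (lift_hasSum (cst b i) (3 * A) (cst_bound hb i) z).mapL (coord n)
  by_cases hi : i ≤ n
  · rw [if_pos hi]
    refine h1.unique ?_
    have h2 : b i * z (n - i) = coord n (z (n - i) • cst b i (n - i)) := by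
      simp only [coord_apply, cst, lp.coeFn_smul, lp.coeFn_add, Pi.smul_apply, Pi.add_apply,
        bas_apply, smul_eq_mul]
      rcases eq_or_lt_of_le hi with rfl | h
      · simp [hz]
      · rw [if_pos (by omega), if_neg (c := n = i - (n - i)) (by omega)]
        ring
    rw [h2]
    refine hasSum_single _ (fun j hj => ?_)
    simp only [coord_apply, cst, lp.coeFn_smul, lp.coeFn_add, Pi.smul_apply, Pi.add_apply,
        bas_apply, smul_eq_mul]
    rcases Nat.eq_zero_or_pos j with rfl | h
    · simp [hz]
    · rw [if_neg (by omega), if_neg (c := n = i - j) (by omega)]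
      simp
  · rw [if_neg hi]
    refine h1.unique ?_
    have h2 : (b i - b (i - n)) * z (i - n) = coord n (z (i - n) • cst b i (i - n)) := by
      simp only [coord_apply, cst, lp.coeFn_smul, lp.coeFn_add, Pi.smul_apply, Pi.add_apply,
        bas_apply, smul_eq_mul]
      rw [if_neg (by omega), if_pos (by omega), if_pos (by omega)]
      ring
    rw [h2]
    refine hasSum_single _ (fun j hj => ?_)
    simp only [coord_apply, cst, lp.coeFn_smul, lp.coeFn_add, Pi.smul_apply, Pi.add_apply,
        bas_apply, smul_eq_mul]
    rw [if_neg (by omega), if_neg (c := n = i - j) (by omega)]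
    simp

lemma bil_hasSum (b : ℕ → ℝ) (A : ℝ) (hA : 0 ≤ A) (hb : ∀ n, |b n| ≤ A) (n : ℕ) (hn : 1 ≤ n)
    (y z : L1) (hz : z 0 = 0) :
    HasSum (fun i => y i * (if i ≤ n then b i * z (n - i) else (b i - b (i - n)) * z (i - n)))
      ((bil b A hA hb y z) n) := by
  have h1 := (lift_hasSum (fun i => lift (cst b i) (3 * A) (cst_bound hb i)) (3 * A)
    (fun i => norm_lift_le _ _ (by linarith) _) y).mapL (ContinuousLinearMap.apply ℝ L1 z)
  have h2 := h1.mapL (coord n)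
  convert h2 using 2 with i
  · simp [coord_apply, inner_apply b A hb i n hn z hz]
  · rfl

lemma bil_apply (b : ℕ → ℝ) (A : ℝ) (hA : 0 ≤ A) (hb : ∀ n, |b n| ≤ A) (n : ℕ) (hn : 1 ≤ n)
    (y : L1) (hy : y 0 = 0) :
    (Summable fun k : ℕ => (b (n + k + 1) - b (k + 1)) * y (n + k + 1) * y (k + 1)) ∧
    (bil b A hA hb y y) n = ∑ j ∈ Finset.Ico 1 n, b j * y j * y (n - j)
      + ∑' k : ℕ, (b (n + k + 1) - b (k + 1)) * y (n + k + 1) * y (k + 1) := by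
  have h1 := bil_hasSum b A hA hb n hn y y hy
  set f : ℕ → ℝ := fun i =>
    y i * (if i ≤ n then b i * y (n - i) else (b i - b (i - n)) * y (i - n)) with hf
  have hshift : ∀ k, f (k + (n + 1)) = (b (n + k + 1) - b (k + 1)) * y (n + k + 1) * y (k + 1) := by
    intro k
    have e1 : k + (n + 1) = n + k + 1 := by ring
    have e2 : n + k + 1 - n = k + 1 := by omega
    simp only [hf]
    rw [if_neg (by omega), e1, e2]
    ring
  have hs : Summable fun k => f (k + (n + 1)) := (summable_nat_add_iff (n + 1)).2 h1.summable
  simp only [hshift] at hs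
  refine ⟨hs, ?_⟩
  rw [← h1.tsum_eq, ← h1.summable.sum_add_tsum_nat_add (n + 1)]
  congr 1
  · rw [Finset.range_eq_Ico, Finset.sum_Ico_succ_top (by omega),
      Finset.sum_eq_sum_Ico_succ_bot (by omega)]
    have e0 : f 0 = 0 := by simp [hf, hy]
    have en : f n = 0 := by simp [hf, hy]
    rw [e0, en, zero_add, add_zero]
    refine Finset.sum_congr rfl (fun j hj => ?_)
    rw [Finset.mem_Ico] at hj
    simp only [hf]
    rw [if_pos (by omega)]
    ring
  · exact tsum_congr hshift

lemma ift_branch {E : Type*} [NormedAddCommGroup E] [NormedSpace ℝ E] [CompleteSpace E]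
    (Mb U V : E →L[ℝ] E) (G : E →L[ℝ] E →L[ℝ] E) (z0 : E) (hz0 : z0 = U (G z0 z0))
    (K : E →L[ℝ] E) (hKdef : ∀ h, K h = U (G z0 h + G h z0))
    (hK : ∀ h, K (K (K h)) = K (K h) + (2 : ℝ) • K h) :
    ∃ δ : ℝ, 0 < δ ∧ ∃ C : ℝ, 0 < C ∧ ∃ ψ dψ : ℝ → E, ∀ s ∈ Set.Ioo (-δ) δ,
      ψ s + s • Mb (ψ s) - (1 - s) • U (G (ψ s) (ψ s)) - (s * (1 - s)) • V (G (ψ s) (ψ s)) = 0 ∧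
      HasDerivAt ψ (dψ s) s ∧ ‖ψ s - z0‖ ≤ C * |s| ∧ ‖dψ s‖ ≤ C := by
  set F : ℝ × E → E := fun q => q.2 + q.1 • Mb q.2 - (1 - q.1) • U (G q.2 q.2)
    - (q.1 * (1 - q.1)) • V (G q.2 q.2) with hF
  have hFs : ContDiff ℝ 1 F := by
    have hG : ContDiff ℝ 1 (fun q : ℝ × E => G q.2 q.2) :=
      (G.contDiff.comp contDiff_snd).clm_apply contDiff_snd
    have h1 : ContDiff ℝ 1 (fun q : ℝ × E => U (G q.2 q.2)) := U.contDiff.comp hG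
    have h2 : ContDiff ℝ 1 (fun q : ℝ × E => V (G q.2 q.2)) := V.contDiff.comp hG
    have h3 : ContDiff ℝ 1 (fun q : ℝ × E => Mb q.2) := Mb.contDiff.comp contDiff_snd
    have hc : ContDiff ℝ 1 (fun q : ℝ × E => 1 - q.1) := contDiff_const.sub contDiff_fst
    exact ((contDiff_snd.add (contDiff_fst.smul h3)).sub (hc.smul h1)).sub
      ((contDiff_fst.mul hc).smul h2)
  have hcd : ContDiffAt ℝ 1 F (0, z0) := hFs.contDiffAt
  have hpart : fderiv ℝ F (0, z0) ∘L .inr ℝ ℝ E = ContinuousLinearMap.id ℝ E - K := by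
    have h1 : HasFDerivAt F (fderiv ℝ F (0, z0)) (0, z0) :=
      (hcd.differentiableAt (by norm_num)).hasFDerivAt
    have h2 : HasFDerivAt (fun z : E => ((0 : ℝ), z)) (.inr ℝ ℝ E) z0 :=
      hasFDerivAt_prodMk_right _ _
    have h3 := h1.comp z0 h2
    have h4 : HasFDerivAt (fun z : E => z - U (G z z)) (ContinuousLinearMap.id ℝ E - K) z0 := by
      have h5 : HasFDerivAt (fun z : E => G z z) _ z0 :=
        (G.hasFDerivAt (x := z0)).clm_apply (hasFDerivAt_id z0)
      have h6 := U.hasFDerivAt.comp z0 h5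
      have h7 := (hasFDerivAt_id z0).sub h6
      refine h7.congr_fderiv ?_
      ext h
      simp [hKdef]
    refine h3.unique (h4.congr_of_eventuallyEq (Eventually.of_forall fun z => ?_))
    simp [hF]
  have hinv : (fderiv ℝ F (0, z0) ∘L .inr ℝ ℝ E).IsInvertible := by
    rw [hpart]
    refine ⟨ContinuousLinearEquiv.equivOfInverse (ContinuousLinearMap.id ℝ E - K)
      (ContinuousLinearMap.id ℝ E - (1 / 2 : ℝ) • (K ∘L K)) ?_ ?_, ?_⟩
    · intro h
      simp only [sub_apply, ContinuousLinearMap.id_apply,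
        smul_apply, ContinuousLinearMap.comp_apply, map_sub, hK]
      module
    · intro h
      simp only [sub_apply, ContinuousLinearMap.id_apply,
        smul_apply, ContinuousLinearMap.comp_apply, map_sub, map_smul, hK]
      module
    · ext h
      rfl
  have hF0 : F (0, z0) = 0 := by
    simp only [hF]
    rw [← hz0]
    simp
  set ψ := hcd.implicitFunction one_ne_zero hinv with hψ
  have e1 : ∀ᶠ s in 𝓝 (0 : ℝ), F (s, ψ s) = 0 := by
    have := hcd.eventually_apply_implicitFunction one_ne_zero hinv
    rw [hF0] at this
    exact this
  have e2 : ψ 0 = z0 := hcd.implicitFunction_apply_self one_ne_zero hinv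
  have e3 : ContDiffAt ℝ 1 ψ 0 := hcd.contDiffAt_implicitFunction one_ne_zero hinv
  obtain ⟨L, t, ht, hL⟩ := e3.exists_lipschitzOnWith
  have e4 : ∀ᶠ s in 𝓝 (0 : ℝ), ContDiffAt ℝ 1 ψ s := e3.eventually (by simp)
  have e5 : ∀ᶠ s in 𝓝 (0 : ℝ), t ∈ 𝓝 s := eventually_eventually_nhds.2 ht
  obtain ⟨δ, hδ, hball⟩ := Metric.eventually_nhds_iff.1 (e1.and (e4.and e5))
  refine ⟨δ, hδ, L + 1, by positivity, ψ, deriv ψ, fun s hs => ?_⟩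
  obtain ⟨g1, g2, g3⟩ := hball (y := s) (by rw [Real.dist_eq, sub_zero]; exact abs_lt.2 hs)
  refine ⟨g1, (g2.differentiableAt (by norm_num)).hasDerivAt, ?_, ?_⟩
  · have := hL.dist_le_mul s (mem_of_mem_nhds g3) 0 (mem_of_mem_nhds ht)
    rw [e2, dist_eq_norm, Real.dist_eq, sub_zero] at this
    have h0 := abs_nonneg s
    linarith
  · have := norm_deriv_le_of_lipschitzOn g3 hL
    linarith

lemma inv_bound (n : ℕ) : |((n : ℝ))⁻¹| ≤ 1 := by
  rw [abs_of_nonneg (by positivity)]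
  rcases Nat.eq_zero_or_pos n with rfl | h
  · simp
  · exact inv_le_one_of_one_le₀ (by exact_mod_cast h)

/-- Division of the `n`-th coordinate by `n`. -/
def divOp : L1 →L[ℝ] L1 := mulOp (fun n => ((n : ℝ))⁻¹) 1 inv_bound

lemma divOp_apply (h : L1) (n : ℕ) : (divOp h) n = ((n : ℝ))⁻¹ * h n := mulOp_apply _ _ _ _ _

lemma divOp_term_le (h : L1) (k : ℕ) :
    (1 + ((k + 1 : ℕ) : ℝ) ^ 2) * (divOp h (k + 1)) ^ 2 ≤ 2 * ‖h‖ * |h (k + 1)| := by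
  rw [divOp_apply]
  have h1 : (1 : ℝ) ≤ ((k + 1 : ℕ) : ℝ) := by exact_mod_cast Nat.succ_le_succ (Nat.zero_le k)
  set c : ℝ := ((k + 1 : ℕ) : ℝ) with hc
  have h2 : |h (k + 1)| ≤ ‖h‖ := by
    have := lp.norm_apply_le_norm (p := 1) one_ne_zero h (k + 1)
    simpa using this
  have h3 : (1 + c ^ 2) * (c⁻¹ * h (k + 1)) ^ 2 = (1 + c ^ 2) / c ^ 2 * |h (k + 1)| ^ 2 := by
    rw [sq_abs]
    field_simp
  have h4 : (1 + c ^ 2) / c ^ 2 ≤ 2 := by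
    rw [div_le_iff₀ (by positivity)]
    nlinarith
  rw [h3]
  have h5 := abs_nonneg (h (k + 1))
  calc (1 + c ^ 2) / c ^ 2 * |h (k + 1)| ^ 2 ≤ 2 * |h (k + 1)| ^ 2 :=
        mul_le_mul_of_nonneg_right h4 (by positivity)
    _ ≤ 2 * ‖h‖ * |h (k + 1)| := by nlinarith

lemma memL2w_divOp (h : L1) : MemL2w (fun n => divOp h n) := by
  refine Summable.of_nonneg_of_le (fun k => by positivity) (divOp_term_le h) ?_
  exact (((summable_nat_add_iff 1).2 h.summable_abs)).mul_left _

lemma wnorm_divOp (h : L1) : wnorm (fun n => divOp h n) ≤ 2 * ‖h‖ := by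
  have hs : Summable fun k => |h (k + 1)| := (summable_nat_add_iff 1).2 h.summable_abs
  have h1 : wnormSq (fun n => divOp h n) ≤ 2 * ‖h‖ * ∑' k, |h (k + 1)| := by
    rw [← tsum_mul_left]
    exact Summable.tsum_le_tsum (divOp_term_le h) (memL2w_divOp h) (hs.mul_left _)
  have h2 : ∑' k, |h (k + 1)| ≤ ‖h‖ := by
    have := h.summable_abs.sum_add_tsum_nat_add 1
    rw [L1.norm_eq, ← this]
    have : 0 ≤ ∑ i ∈ Finset.range 1, |h i| := Finset.sum_nonneg fun _ _ => abs_nonneg _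
    linarith
  have h0 := norm_nonneg h
  refine Real.sqrt_le_iff.2 ⟨by positivity, h1.trans ?_⟩
  nlinarith

/-- The scaled basis vector. -/
def fb (n : ℕ) : L1 := (n : ℝ) • bas n

lemma divOp_fb (n : ℕ) (hn : 1 ≤ n) : divOp (fb n) = bas n := by
  rw [fb, map_smul, divOp, mulOp_bas, smul_smul, mul_inv_cancel₀, one_smul]
  positivity

section algebra
variable (a : ℕ → ℝ) (aval : ℝ) (hav : 0 < aval)
    (l m : ℕ) (hm : 1 ≤ m) (hml : m < l) (hl2m : l ≠ 2 * m)
    (hal : a l = aval) (ham : a m = aval) (halm : a (l + m) = aval)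
    (u : ℕ → ℝ) (Cu : ℝ) (hu : ∀ n, |u n| ≤ Cu)
    (hul : u l = aval⁻¹) (hum : u m = aval⁻¹) (hulm : u (l + m) = aval⁻¹)
    (hu0 : ∀ n, n ≠ l → n ≠ m → n ≠ l + m → u n = 0)
    (A : ℝ) (hA : 0 ≤ A) (hb : ∀ n, |(fun n : ℕ => (n : ℝ) * a n) n| ≤ A)

/-- The bilinear map in the rescaled variables. -/
def bilG : L1 →L[ℝ] L1 →L[ℝ] L1 :=
  (bil (fun n : ℕ => (n : ℝ) * a n) A hA hb).bilinearComp divOp divOp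

lemma bilG_apply (y z : L1) :
    bilG a A hA hb y z = bil (fun n : ℕ => (n : ℝ) * a n) A hA hb (divOp y) (divOp z) := rfl

include hav hm hml hl2m hal ham halm hul hum hulm hu0 in
lemma table :
    mulOp u Cu hu (bilG a A hA hb (fb l) (fb l)) = 0 ∧
    mulOp u Cu hu (bilG a A hA hb (fb m) (fb m)) = 0 ∧
    mulOp u Cu hu (bilG a A hA hb (fb (l + m)) (fb (l + m))) = 0 ∧
    mulOp u Cu hu (bilG a A hA hb (fb l) (fb m)) = (l : ℝ) • bas (l + m) ∧
    mulOp u Cu hu (bilG a A hA hb (fb m) (fb l)) = (m : ℝ) • bas (l + m) ∧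
    mulOp u Cu hu (bilG a A hA hb (fb l) (fb (l + m))) = 0 ∧
    mulOp u Cu hu (bilG a A hA hb (fb (l + m)) (fb l)) = fb m ∧
    mulOp u Cu hu (bilG a A hA hb (fb m) (fb (l + m))) = 0 ∧
    mulOp u Cu hu (bilG a A hA hb (fb (l + m)) (fb m)) = fb l := by
  have hl : 1 ≤ l := by omega
  have hlm : 1 ≤ l + m := by omega
  have ha0 : aval ≠ 0 := hav.ne'
  simp only [bilG_apply, divOp_fb l hl, divOp_fb m hm, divOp_fb (l + m) hlm, bil_bas, cst,
    map_add, map_smul, mulOp_bas, hal, ham, halm]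
  have z1 : u (l + l) = 0 := hu0 _ (by omega) (by omega) (by omega)
  have z2 : u (m + m) = 0 := hu0 _ (by omega) (by omega) (by omega)
  have z3 : u (l + m + (l + m)) = 0 := hu0 _ (by omega) (by omega) (by omega)
  have z4 : u (l - m) = 0 := hu0 _ (by omega) (by omega) (by omega)
  have z5 : u (l + (l + m)) = 0 := hu0 _ (by omega) (by omega) (by omega)
  have z6 : u (m + (l + m)) = 0 := hu0 _ (by omega) (by omega) (by omega)
  have z7 : u (l + m + l) = 0 := hu0 _ (by omega) (by omega) (by omega)
  have z8 : u (l + m + m) = 0 := hu0 _ (by omega) (by omega) (by omega)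
  have c1 : ¬ (l < m) := by omega
  have c3 : l < l + m := by omega
  have c4 : m < l + m := by omega
  have c5 : ¬ (l + m < l) := by omega
  have c6 : ¬ (l + m < m) := by omega
  have s1 : l + m - l = m := by omega
  have s2 : l + m - m = l := by omega
  have s3 : m + l = l + m := by omega
  refine ⟨?_, ?_, ?_, ?_, ?_, ?_, ?_, ?_, ?_⟩
  · simp [z1]
  · simp [z2]
  · simp [z3]
  · simp only [z4, hulm, smul_smul, zero_smul, smul_zero, add_zero]
    congr 1; field_simp
  · simp only [c1, if_false, s3, hulm, smul_smul, zero_mul, zero_smul, add_zero]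
    congr 1; field_simp
  · simp [z5, c5]
  · simp only [z7, c3, if_true, s1, hum, smul_smul, zero_smul, smul_zero, zero_add, fb]
    congr 1; push_cast; field_simp; ring
  · simp [z6, c6]
  · simp only [z8, c4, if_true, s2, hul, smul_smul, zero_smul, smul_zero, zero_add, fb]
    congr 1; push_cast; field_simp; ring

include hm hml hu0 in
lemma range_U (w : L1) : ∃ x y t : ℝ,
    mulOp u Cu hu w = x • fb l + y • fb m + t • fb (l + m) := by
  have hl : (l : ℝ) ≠ 0 := by have : 0 < l := by omega
                              positivity
  have hm' : (m : ℝ) ≠ 0 := by positivity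
  have hlm : ((l + m : ℕ) : ℝ) ≠ 0 := by positivity
  refine ⟨u l * w l / l, u m * w m / m, u (l + m) * w (l + m) / ((l + m : ℕ) : ℝ), ?_⟩
  ext n
  rw [mulOp_apply]
  simp only [fb, smul_smul, lp.coeFn_add, lp.coeFn_smul, Pi.add_apply, Pi.smul_apply, bas_apply,
    smul_eq_mul, div_mul_cancel₀ _ hl, div_mul_cancel₀ _ hm', div_mul_cancel₀ _ hlm]
  by_cases h1 : n = l
  · subst h1
    rw [if_pos rfl, if_neg (by omega), if_neg (by omega)]; ring
  by_cases h2 : n = m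
  · subst h2
    rw [if_pos rfl, if_neg (by omega), if_neg (by omega)]; ring
  by_cases h3 : n = l + m
  · subst h3
    rw [if_pos rfl, if_neg (by omega), if_neg (by omega)]; ring
  rw [hu0 n h1 h2 h3, if_neg h1, if_neg h2, if_neg h3]; ring

variable (σ₁ σ₂ σ₃ : ℝ)
    (hσ₁ : σ₁ = 1 ∨ σ₁ = -1) (hσ₂ : σ₂ = 1 ∨ σ₂ = -1) (hσ₃ : σ₃ = 1 ∨ σ₃ = -1)
    (hprod : σ₁ * σ₂ * σ₃ = 1)

lemma fb_add : (fb (l + m)) = (l : ℝ) • bas (l + m) + (m : ℝ) • bas (l + m) := by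
  rw [fb]; push_cast; rw [add_smul]

/-- The leading profile. -/
def zz : L1 := σ₁ • fb l + σ₂ • fb m + σ₃ • fb (l + m)

/-- The linearised operator. -/
def KK : L1 →L[ℝ] L1 :=
  (mulOp u Cu hu) ∘L (bilG a A hA hb (zz l m σ₁ σ₂ σ₃) + (bilG a A hA hb).flip (zz l m σ₁ σ₂ σ₃))

lemma KK_apply (h : L1) : KK a l m u Cu hu A hA hb σ₁ σ₂ σ₃ h =
    mulOp u Cu hu (bilG a A hA hb (zz l m σ₁ σ₂ σ₃) h + bilG a A hA hb h (zz l m σ₁ σ₂ σ₃)) := rfl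

include hav hm hml hl2m hal ham halm hul hum hulm hu0 hσ₁ hσ₂ hσ₃ hprod in
lemma zz_eq : zz l m σ₁ σ₂ σ₃ =
    mulOp u Cu hu (bilG a A hA hb (zz l m σ₁ σ₂ σ₃) (zz l m σ₁ σ₂ σ₃)) := by
  obtain ⟨t1, t2, t3, t4, t5, t6, t7, t8, t9⟩ := table a aval hav l m hm hml hl2m hal ham halm
    u Cu hu hul hum hulm hu0 A hA hb
  simp only [zz, map_add, map_smul, add_apply, smul_apply, t1, t2, t3, t4, t5, t6, t7, t8, t9]
  rw [fb_add]
  rcases hσ₁ with rfl | rfl <;> rcases hσ₂ with rfl | rfl <;> rcases hσ₃ with rfl | rfl <;>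
    first
    | (exfalso; norm_num at hprod; done)
    | module

include hav hm hml hl2m hal ham halm hul hum hulm hu0 in
lemma KK_fb : KK a l m u Cu hu A hA hb σ₁ σ₂ σ₃ (fb l) = σ₂ • fb (l + m) + σ₃ • fb m ∧
    KK a l m u Cu hu A hA hb σ₁ σ₂ σ₃ (fb m) = σ₁ • fb (l + m) + σ₃ • fb l ∧
    KK a l m u Cu hu A hA hb σ₁ σ₂ σ₃ (fb (l + m)) = σ₁ • fb m + σ₂ • fb l := by
  obtain ⟨t1, t2, t3, t4, t5, t6, t7, t8, t9⟩ := table a aval hav l m hm hml hl2m hal ham halm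
    u Cu hu hul hum hulm hu0 A hA hb
  simp only [KK_apply, zz, map_add, map_smul, add_apply, smul_apply, t1, t2, t3, t4, t5, t6, t7,
    t8, t9]
  rw [fb_add]
  refine ⟨by module, by module, by module⟩

include hav hm hml hl2m hal ham halm hul hum hulm hu0 hσ₁ hσ₂ hσ₃ hprod in
lemma KK_cubic (h : L1) :
    KK a l m u Cu hu A hA hb σ₁ σ₂ σ₃ (KK a l m u Cu hu A hA hb σ₁ σ₂ σ₃
      (KK a l m u Cu hu A hA hb σ₁ σ₂ σ₃ h)) =
    KK a l m u Cu hu A hA hb σ₁ σ₂ σ₃ (KK a l m u Cu hu A hA hb σ₁ σ₂ σ₃ h)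
      + (2 : ℝ) • KK a l m u Cu hu A hA hb σ₁ σ₂ σ₃ h := by
  obtain ⟨x, y, t, e⟩ := range_U l m hm hml u Cu hu hu0
    (bilG a A hA hb (zz l m σ₁ σ₂ σ₃) h + bilG a A hA hb h (zz l m σ₁ σ₂ σ₃))
  rw [← KK_apply] at e
  obtain ⟨k1, k2, k3⟩ := KK_fb a aval hav l m hm hml hl2m hal ham halm
    u Cu hu hul hum hulm hu0 A hA hb σ₁ σ₂ σ₃
  rw [e]
  simp only [map_add, map_smul, k1, k2, k3]
  rcases hσ₁ with rfl | rfl <;> rcases hσ₂ with rfl | rfl <;> rcases hσ₃ with rfl | rfl <;>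
    first
    | (exfalso; norm_num at hprod; done)
    | module
end algebra

lemma zz_coord (l m : ℕ) (hm : 1 ≤ m) (hml : m < l) (σ₁ σ₂ σ₃ : ℝ) (n : ℕ) :
    divOp (zz l m σ₁ σ₂ σ₃) n = σ₁ * (if n = l then 1 else 0) + σ₂ * (if n = m then 1 else 0)
              + σ₃ * (if n = l + m then 1 else 0) := by
  simp only [zz, map_add, map_smul, divOp_fb l (by omega), divOp_fb m hm,
    divOp_fb (l + m) (by omega), lp.coeFn_add, lp.coeFn_smul, Pi.add_apply, Pi.smul_apply,
    bas_apply, smul_eq_mul]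

lemma bdd_of_tendsto {f : ℕ → ℝ} {c : ℝ} (h : Tendsto f atTop (𝓝 c)) : ∃ C, ∀ n, |f n| ≤ C := by
  obtain ⟨C, hC⟩ := h.abs.bddAbove_range
  exact ⟨C, fun n => hC ⟨n, rfl⟩⟩

/-- transcritical bifurcating branches in the resonance case
`a_l = a_m = a_{l+m} = a` (with `m < l`, `l ≠ 2m`). For every sign vector `(σ₁,σ₂,σ₃)` with
`σ₁σ₂σ₃ = 1` there is a differentiable branch `p^σ(s)` solving the system at
`κ(s) = (2/a)(1 − s)`, tangent to `σ₁ e_l + σ₂ e_m + σ₃ e_{l+m}`. -/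
theorem transcritical_branches
    (a : ℕ → ℝ) (hA : ∃ C : ℝ, ∀ ℓ : ℕ, 1 ≤ ℓ → (ℓ : ℝ) * |a ℓ| ≤ C)
    (aval : ℝ) (hav : 0 < aval)
    (l m : ℕ) (hm : 1 ≤ m) (hml : m < l) (hl2m : l ≠ 2 * m)
    (hal : a l = aval) (ham : a m = aval) (halm : a (l + m) = aval)
    (hout : ∀ j : ℕ, 1 ≤ j → j ≠ l → j ≠ m → j ≠ l + m → a j < aval)
    (σ₁ σ₂ σ₃ : ℝ)
    (hσ₁ : σ₁ = 1 ∨ σ₁ = -1) (hσ₂ : σ₂ = 1 ∨ σ₂ = -1) (hσ₃ : σ₃ = 1 ∨ σ₃ = -1)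
    (hprod : σ₁ * σ₂ * σ₃ = 1) :
    ∃ δ : ℝ, 0 < δ ∧ ∃ C : ℝ, 0 < C ∧ ∃ p dp : ℝ → ℕ → ℝ,
      ∀ s ∈ Set.Ioo (-δ) δ,
        MemL2w (p s) ∧
        SolvesMV a ((2 / aval) * (1 - s)) (p s) ∧
        wnorm (fun n =>
            p s n - s * (σ₁ * (if n = l then 1 else 0) + σ₂ * (if n = m then 1 else 0)
              + σ₃ * (if n = l + m then 1 else 0)))
          ≤ C * s ^ 2 ∧
        (∀ n : ℕ, HasDerivAt (fun t => p t n) (dp s n) s) ∧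
        wnorm (fun n =>
            dp s n - (σ₁ * (if n = l then 1 else 0) + σ₂ * (if n = m then 1 else 0)
              + σ₃ * (if n = l + m then 1 else 0)))
          ≤ C * |s| := by
  obtain ⟨A, hA1⟩ := hA
  have hA0 : 0 ≤ A := le_trans (by positivity) (hA1 1 le_rfl)
  have hb : ∀ n, |(fun n : ℕ => (n : ℝ) * a n) n| ≤ A := by
    intro n
    simp only [abs_mul, Nat.abs_cast]
    rcases Nat.eq_zero_or_pos n with rfl | h
    · simpa using hA0
    · exact hA1 n h
  have ha0 : aval ≠ 0 := hav.ne'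
  have hat : Tendsto a atTop (𝓝 0) := by
    refine squeeze_zero_norm' (a := fun n : ℕ => A / (n : ℝ)) ?_ (tendsto_const_div_atTop_nhds_zero_nat A)
    filter_upwards [eventually_ge_atTop 1] with n hn
    have hn' : (0 : ℝ) < n := by exact_mod_cast hn
    rw [Real.norm_eq_abs, le_div_iff₀ hn', mul_comm]
    exact hA1 n hn
  set γ : ℕ → ℝ := fun n => (1 - a n / aval)⁻¹ with hγ
  have hαt : Tendsto (fun n => a n / aval) atTop (𝓝 0) := by
    simpa using hat.div_const aval
  have hγt : Tendsto γ atTop (𝓝 1) := by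
    have h1 : Tendsto (fun n => 1 - a n / aval) atTop (𝓝 (1 - 0)) := tendsto_const_nhds.sub hαt
    have h2 := h1.inv₀ (by norm_num)
    simpa using h2
  obtain ⟨Cβ, hβ⟩ := bdd_of_tendsto (hαt.mul hγt)
  obtain ⟨Cv, hv⟩ := bdd_of_tendsto (hγt.mul_const aval⁻¹)
  set u : ℕ → ℝ := fun n => if n = l ∨ n = m ∨ n = l + m then aval⁻¹ else 0 with hudef
  have hu : ∀ n, |u n| ≤ aval⁻¹ := by
    intro n
    have : 0 < aval⁻¹ := inv_pos.2 hav
    simp only [hudef]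
    split_ifs
    · rw [abs_of_pos this]
    · simpa using this.le
  have hul : u l = aval⁻¹ := by simp [hudef]
  have hum : u m = aval⁻¹ := by simp [hudef]
  have hulm : u (l + m) = aval⁻¹ := by simp [hudef]
  have hu0 : ∀ n, n ≠ l → n ≠ m → n ≠ l + m → u n = 0 := by
    intro n h1 h2 h3
    simp [hudef, h1, h2, h3]
  obtain ⟨δ, hδ, C, hC, ψ, dψ, hψ⟩ := ift_branch (mulOp _ Cβ hβ) (mulOp u _ hu) (mulOp _ Cv hv)
    (bilG a A hA0 hb) (zz l m σ₁ σ₂ σ₃)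
    (zz_eq a aval hav l m hm hml hl2m hal ham halm u _ hu hul hum hulm hu0 A hA0 hb σ₁ σ₂ σ₃
      hσ₁ hσ₂ hσ₃ hprod)
    (KK a l m u _ hu A hA0 hb σ₁ σ₂ σ₃) (KK_apply a l m u _ hu A hA0 hb σ₁ σ₂ σ₃)
    (KK_cubic a aval hav l m hm hml hl2m hal ham halm u _ hu hul hum hulm hu0 A hA0 hb σ₁ σ₂ σ₃
      hσ₁ hσ₂ hσ₃ hprod)
  refine ⟨δ, hδ, 4 * C, by positivity, fun s n => divOp (s • ψ s) n,
    fun s n => divOp (ψ s + s • dψ s) n, fun s hs => ?_⟩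
  obtain ⟨hF, hd, hn1, hn2⟩ := hψ s hs
  refine ⟨memL2w_divOp _, ?_, ?_, ?_, ?_⟩
  · intro n hn
    set y : L1 := divOp (ψ s) with hy
    have hn' : (n : ℝ) ≠ 0 := by positivity
    have hy0 : y 0 = 0 := by simp [hy, divOp_apply]
    have hψn : ψ s n = n * y n := by
      rw [hy, divOp_apply]; field_simp
    obtain ⟨hsum, hQ⟩ := bil_apply (fun n : ℕ => (n : ℝ) * a n) A hA0 hb n hn y hy0
    have hx : ∀ k, (divOp (s • ψ s)) k = s * y k := by
      intro k; rw [map_smul]; rfl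
    simp only [hx]
    have hterm : ∀ k : ℕ, (((n + k + 1 : ℕ) : ℝ) * a (n + k + 1) - ((k + 1 : ℕ) : ℝ) * a (k + 1))
        * (s * y (n + k + 1)) * (s * y (k + 1)) =
        s ^ 2 * ((((n + k + 1 : ℕ) : ℝ) * a (n + k + 1) - ((k + 1 : ℕ) : ℝ) * a (k + 1))
        * y (n + k + 1) * y (k + 1)) := fun k => by ring
    have hfin : ∑ j ∈ Finset.Ico 1 n, (j : ℝ) * a j * (s * y j) * (s * y (n - j)) =
        s ^ 2 * ∑ j ∈ Finset.Ico 1 n, (j : ℝ) * a j * y j * y (n - j) := by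
      rw [Finset.mul_sum]
      exact Finset.sum_congr rfl fun j _ => by ring
    simp only [hterm]
    refine ⟨hsum.mul_left _, ?_⟩
    rw [tsum_mul_left, hfin]
    simp only at hQ
    set S1 := ∑ j ∈ Finset.Ico 1 n, (j : ℝ) * a j * y j * y (n - j)
    set S2 := ∑' k : ℕ, (((n + k + 1 : ℕ) : ℝ) * a (n + k + 1) - ((k + 1 : ℕ) : ℝ) * a (k + 1))
        * y (n + k + 1) * y (k + 1)
    have hFn := congrArg (coord n) hF
    simp only [map_add, map_sub, map_smul, map_zero, coord_apply, mulOp_apply, bilG_apply,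
      smul_eq_mul] at hFn
    rw [← hy, hQ, hψn] at hFn
    by_cases hres : n = l ∨ n = m ∨ n = l + m
    · have han : a n = aval := by
        rcases hres with h | h | h <;> rw [h] <;> assumption
      have hγn : γ n = 0 := by simp [hγ, han, ha0]
      have hun : u n = aval⁻¹ := by simp only [hudef]; rw [if_pos hres]
      rw [hγn, hun] at hFn
      rw [han]
      have e : (n : ℝ) * y n = (1 - s) * (aval⁻¹ * (S1 + S2)) := by linarith
      calc (n : ℝ) * (2 - 2 / aval * (1 - s) * aval) * (s * y n)
          = 2 * s ^ 2 * (n * y n) := by field_simp; ring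
        _ = _ := by rw [e]; ring
    · push Not at hres
      obtain ⟨h1, h2, h3⟩ := hres
      have hlt : a n / aval < 1 := by
        rw [div_lt_one hav]; exact hout n hn h1 h2 h3
      have hne : 1 - a n / aval ≠ 0 := by linarith
      have hg : γ n * (1 - a n / aval) = 1 := inv_mul_cancel₀ hne
      rw [hu0 n h1 h2 h3] at hFn
      have e : (n : ℝ) * y n * ((1 - a n / aval) + s * (a n / aval))
          = s * (1 - s) * aval⁻¹ * (S1 + S2) := by
        linear_combination (1 - a n / aval) * hFn
          - (s * (a n / aval) * n * y n - s * (1 - s) * aval⁻¹ * (S1 + S2)) * hg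
      have e' : (n : ℝ) * (2 - 2 / aval * (1 - s) * a n) * (s * y n)
          = 2 * s * ((n : ℝ) * y n * ((1 - a n / aval) + s * (a n / aval))) := by ring
      rw [e', e]
      ring
  · have e : (fun n => divOp (s • ψ s) n - s * (σ₁ * (if n = l then 1 else 0)
        + σ₂ * (if n = m then 1 else 0) + σ₃ * (if n = l + m then 1 else 0)))
        = fun n => divOp (s • (ψ s - zz l m σ₁ σ₂ σ₃)) n := by
      funext n
      rw [← zz_coord l m hm hml]
      simp only [map_smul, map_sub, lp.coeFn_smul, lp.coeFn_sub, Pi.smul_apply, Pi.sub_apply,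
        smul_eq_mul]
      ring
    rw [e]
    refine (wnorm_divOp _).trans ?_
    rw [norm_smul, Real.norm_eq_abs, ← sq_abs]
    have h0 := abs_nonneg s
    have := mul_le_mul_of_nonneg_left hn1 h0
    nlinarith [mul_nonneg hC.le (sq_nonneg |s|)]
  · intro n
    have h1 := (hasDerivAt_id s).smul hd
    have h2 := (coord n ∘L divOp).hasFDerivAt.comp_hasDerivAt s h1
    refine h2.congr_deriv ?_
    simp only [ContinuousLinearMap.comp_apply, coord_apply, id, one_smul]
    rw [add_comm]
  · have e : (fun n => divOp (ψ s + s • dψ s) n - (σ₁ * (if n = l then 1 else 0)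
        + σ₂ * (if n = m then 1 else 0) + σ₃ * (if n = l + m then 1 else 0)))
        = fun n => divOp ((ψ s - zz l m σ₁ σ₂ σ₃) + s • dψ s) n := by
      funext n
      rw [← zz_coord l m hm hml]
      simp only [map_add, map_smul, map_sub, lp.coeFn_smul, lp.coeFn_sub, lp.coeFn_add,
        Pi.smul_apply, Pi.sub_apply, Pi.add_apply, smul_eq_mul]
      ring
    rw [e]
    refine (wnorm_divOp _).trans ?_
    have h0 := abs_nonneg s
    have h1 := norm_add_le (ψ s - zz l m σ₁ σ₂ σ₃) (s • dψ s)
    rw [norm_smul, Real.norm_eq_abs] at h1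
    have h2 := mul_le_mul_of_nonneg_left hn2 h0
    nlinarith
end
end

section
/- Let b : ℕ≥1 → ℝ satisfy sup_{ℓ≥1} ℓ|b_ℓ| < ∞, ∑_{ℓ≥1} |b_ℓ| < ∞, b₁ > 0, and b_ℓ ≠ b₁ for every ℓ ≥ 2. Then there exist δ ∈ (0, 2/b₁), η > 0 and constants C_ℓ > 0 (ℓ ≥ 1) such that: 2 − κ b_ℓ ≠ 0 for all ℓ ≥ 2 and all κ ∈ I := [2/b₁ − δ, 2/b₁ + δ], so that for κ ∈ I the recursion z₁(κ) := 1, z_ℓ(κ) := κ (ℓ(2 − κ b_ℓ))⁻¹ ∑_{j=1}^{ℓ−1} j b_j z_j(κ) z_{ℓ−j}(κ) (ℓ ≥ 2) is well defined; and for every κ ∈ I and every x ∈ ℓ²_w with ‖x‖_w ≤ η solving the stationary Fourier system (with coefficients b) at κ, one has |x_ℓ − x₁^ℓ z_ℓ(κ)| ≤ C_ℓ |x₁|^{ℓ+2} for every ℓ ≥ 1. -/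
open scoped BigOperators
open Filter Topology Real

noncomputable section

/-- Abstract small-solution class. -/
def RCEGood (G σ : ℝ) (x : ℕ → ℝ) : Prop :=
  (Summable fun k : ℕ => |x (k + 1)|) ∧ (∑' k : ℕ, |x (k + 1)|) ≤ σ ∧
  ∀ ℓ : ℕ, 2 ≤ ℓ → |x ℓ| ≤ G * (∑ j ∈ Finset.Ico 1 ℓ, |x j| * |x (ℓ - j)|
    + ∑' k : ℕ, |x (ℓ + k + 1)| * |x (k + 1)|)

lemma rce_absorb (f : ℕ → ℝ) (m : ℕ) (A N0 : ℝ) (h0 : ∀ ℓ, m ≤ ℓ → f ℓ ≤ N0)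
    (hf : ∀ ℓ, m ≤ ℓ → 0 ≤ f ℓ)
    (h : ∀ N, 0 ≤ N → (∀ ℓ, m ≤ ℓ → f ℓ ≤ N) → ∀ ℓ, m ≤ ℓ → f ℓ ≤ A + N / 2) :
    ∀ ℓ, m ≤ ℓ → f ℓ ≤ 2 * A := by
  have hb : BddAbove (f '' {ℓ | m ≤ ℓ}) := ⟨N0, by rintro _ ⟨l, hl, rfl⟩; exact h0 l hl⟩
  set N := sSup (f '' {ℓ | m ≤ ℓ}) with hN
  have hle : ∀ ℓ, m ≤ ℓ → f ℓ ≤ N := fun l hl => le_csSup hb ⟨l, hl, rfl⟩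
  have hN0 : 0 ≤ N := (hf m le_rfl).trans (hle m le_rfl)
  have h2 := h N hN0 hle
  have : N ≤ A + N / 2 := csSup_le ⟨f m, m, le_refl m, rfl⟩ (by rintro _ ⟨l, hl, rfl⟩; exact h2 l hl)
  intro l hl
  linarith [hle l hl]

lemma rce_le_tsum {x : ℕ → ℝ} (hs : Summable fun k : ℕ => |x (k + 1)|) (ℓ : ℕ) (hl : 1 ≤ ℓ) :
    |x ℓ| ≤ ∑' k : ℕ, |x (k + 1)| := by
  obtain ⟨k, rfl⟩ : ∃ k, ℓ = k + 1 := ⟨ℓ - 1, by omega⟩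
  exact hs.le_tsum k (fun _ _ => abs_nonneg _)

lemma rce_sum_le {x : ℕ → ℝ} (hs : Summable fun k : ℕ => |x (k + 1)|) (ℓ : ℕ) :
    ∑ j ∈ Finset.Ico 1 ℓ, |x j| ≤ ∑' k : ℕ, |x (k + 1)| := by
  rw [Finset.sum_Ico_eq_sum_range]
  simp_rw [add_comm 1]
  exact hs.sum_le_tsum _ (fun _ _ => abs_nonneg _)

lemma rce_tail {x : ℕ → ℝ} (hs : Summable fun k : ℕ => |x (k + 1)|) (ℓ : ℕ) (N : ℝ)
    (hN : ∀ i, ℓ + 1 ≤ i → |x i| ≤ N) :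
    (Summable fun k : ℕ => |x (ℓ + k + 1)| * |x (k + 1)|) ∧
    ∑' k : ℕ, |x (ℓ + k + 1)| * |x (k + 1)| ≤ N * ∑' k : ℕ, |x (k + 1)| := by
  have hle : ∀ k, |x (ℓ + k + 1)| * |x (k + 1)| ≤ N * |x (k + 1)| := fun k =>
    mul_le_mul_of_nonneg_right (hN _ (by omega)) (abs_nonneg _)
  have h1 : Summable fun k : ℕ => |x (ℓ + k + 1)| * |x (k + 1)| :=
    Summable.of_nonneg_of_le (fun k => by positivity) hle (hs.mul_left N)
  refine ⟨h1, ?_⟩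
  rw [← tsum_mul_left]
  exact h1.tsum_le_tsum hle (hs.mul_left N)

lemma rce_step1 (G σ : ℝ) (hG : 0 ≤ G) (hσ : 3 * G * σ ≤ 1 / 2) (hσ1 : σ ≤ 1) (m : ℕ) :
    ∃ D : ℝ, 0 ≤ D ∧ ∀ x : ℕ → ℝ, RCEGood G σ x →
      (∀ j, 1 ≤ j → j ≤ m → |x j| ≤ D * |x 1| ^ j) ∧
      ∀ ℓ, 1 ≤ ℓ → m ≤ ℓ → |x ℓ| ≤ D * |x 1| ^ m := by
  induction m with
  | zero =>
    refine ⟨1, by norm_num, fun x hx => ⟨fun j h1 h2 => by omega, fun l hl _ => ?_⟩⟩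
    simpa using (rce_le_tsum hx.1 l hl).trans (hx.2.1.trans hσ1)
  | succ m ih =>
    obtain ⟨D, hD, ih⟩ := ih
    refine ⟨D + 2 * (1 + G * (m * D ^ 2)), by positivity, fun x hx => ?_⟩
    obtain ⟨hj, hl⟩ := ih x hx
    obtain ⟨hs, hS, heq⟩ := hx
    set y := |x 1| with hy
    have hy0 : 0 ≤ y := abs_nonneg _
    have hy1 : y ≤ 1 := (rce_le_tsum hs 1 le_rfl).trans (hS.trans hσ1)
    set S := ∑' k : ℕ, |x (k + 1)| with hSdef
    have hS0 : 0 ≤ S := tsum_nonneg (fun _ => abs_nonneg _)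
    have key : ∀ l, m + 1 ≤ l → |x l| ≤ 2 * ((1 + G * (m * D ^ 2)) * y ^ (m + 1)) := by
      refine rce_absorb (fun l => |x l|) (m + 1) _ (D * y ^ m)
        (fun l h => hl l (by omega) (by omega)) (fun l _ => abs_nonneg _) ?_
      intro N hN0 hN l hlm
      rcases Nat.lt_or_ge l 2 with h2 | h2
      · obtain rfl : l = 1 := by omega
        obtain rfl : m = 0 := by omega
        simp only [← hy]
        norm_num
        linarith
      have hj' : ∀ j, 1 ≤ j → j ≤ m → |x j| ≤ D * y ^ j := hj
      have hterm : ∀ j ∈ Finset.Ico 1 l, |x j| * |x (l - j)| ≤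
          N * (|x j| + |x (l - j)|) + (if j < m + 1 then D ^ 2 * y ^ (m + 1) else 0) := by
        intro j hjm
        rw [Finset.mem_Ico] at hjm
        have a1 := abs_nonneg (x j)
        have a2 := abs_nonneg (x (l - j))
        have hE : 0 ≤ (if j < m + 1 then D ^ 2 * y ^ (m + 1) else 0) := by
          split_ifs <;> positivity
        by_cases c1 : m + 1 ≤ j
        · have := mul_le_mul_of_nonneg_right (hN j c1) a2
          nlinarith [mul_nonneg hN0 a1]
        by_cases c2 : m + 1 ≤ l - j
        · have := mul_le_mul_of_nonneg_left (hN (l - j) c2) a1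
          nlinarith [mul_nonneg hN0 a2]
        rw [if_pos (by omega)]
        have e1 := hj' j hjm.1 (by omega)
        have e2 := hj' (l - j) (by omega) (by omega)
        have e3 : |x j| * |x (l - j)| ≤ (D * y ^ j) * (D * y ^ (l - j)) :=
          mul_le_mul e1 e2 a2 (by positivity)
        have e4 : (D * y ^ j) * (D * y ^ (l - j)) = D ^ 2 * y ^ l := by
          have : y ^ l = y ^ j * y ^ (l - j) := by rw [← pow_add]; congr 1; omega
          rw [this]; ring
        have e5 : y ^ l ≤ y ^ (m + 1) := pow_le_pow_of_le_one hy0 hy1 hlm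
        have e6 : D ^ 2 * y ^ l ≤ D ^ 2 * y ^ (m + 1) := by gcongr
        have : 0 ≤ N * (|x j| + |x (l - j)|) := by positivity
        linarith
      have hsum := Finset.sum_le_sum hterm
      rw [Finset.sum_add_distrib, ← Finset.mul_sum, Finset.sum_add_distrib] at hsum
      have s1 := rce_sum_le hs l
      have s2 : ∑ j ∈ Finset.Ico 1 l, |x (l - j)| ≤ S := by
        have := Finset.sum_Ico_reflect (fun j => |x j|) 1 (m := l) (n := l) (by omega)
        rw [this]
        simpa using s1
      have s3 : ∑ j ∈ Finset.Ico 1 l, (if j < m + 1 then D ^ 2 * y ^ (m + 1) else 0)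
          ≤ m * (D ^ 2 * y ^ (m + 1)) := by
        rw [← Finset.sum_filter, Finset.sum_const, nsmul_eq_mul]
        have : ((Finset.Ico 1 l).filter (fun j => j < m + 1)).card ≤ m := by
          calc _ ≤ (Finset.Ico 1 (m + 1)).card := Finset.card_le_card (by
                intro j; simp only [Finset.mem_filter, Finset.mem_Ico]; omega)
            _ = m := by simp
        gcongr
      have s4 : ∑ j ∈ Finset.Ico 1 l, |x j| * |x (l - j)| ≤
          N * (S + S) + m * (D ^ 2 * y ^ (m + 1)) := by
        have : N * (∑ j ∈ Finset.Ico 1 l, |x j| + ∑ j ∈ Finset.Ico 1 l, |x (l - j)|) ≤ N * (S + S) := by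
          gcongr
        linarith
      have s5 := (rce_tail hs l N (fun i hi => hN i (by omega))).2
      have s6 := heq l h2
      have s7 : G * (∑ j ∈ Finset.Ico 1 l, |x j| * |x (l - j)|
          + ∑' k : ℕ, |x (l + k + 1)| * |x (k + 1)|) ≤
          G * (N * (S + S) + m * (D ^ 2 * y ^ (m + 1)) + N * S) := by
        gcongr
      have s8 : N * (3 * G * S) ≤ N * (1 / 2) := by
        refine mul_le_mul_of_nonneg_left (le_trans ?_ hσ) hN0
        gcongr
      have : 0 ≤ y ^ (m + 1) := by positivity
      show |x l| ≤ _
      nlinarith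
    have hA : 0 ≤ 2 * (1 + G * (m * D ^ 2)) := by positivity
    have gen : ∀ l, m + 1 ≤ l →
        |x l| ≤ (D + 2 * (1 + G * (m * D ^ 2))) * y ^ (m + 1) := by
      intro l h
      have := key l h
      have : 0 ≤ D * y ^ (m + 1) := by positivity
      linarith
    refine ⟨fun j h1 h2 => ?_, fun l _ h => gen l h⟩
    rcases Nat.lt_or_ge j (m + 1) with h | h
    · have := hj j h1 (by omega)
      have : 0 ≤ 2 * (1 + G * (m * D ^ 2)) * y ^ j := by positivity
      show |x j| ≤ _
      linarith
    · obtain rfl : j = m + 1 := by omega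
      exact gen _ le_rfl

/-- The tail is of order `ℓ + 2`. -/
lemma rce_tail2 (G σ : ℝ) (hG : 0 ≤ G) (hσ : 3 * G * σ ≤ 1 / 2) (hσ1 : σ ≤ 1) (l : ℕ) :
    ∃ D : ℝ, 0 ≤ D ∧ ∀ x : ℕ → ℝ, RCEGood G σ x →
      ∑' k : ℕ, |x (l + k + 1)| * |x (k + 1)| ≤ D * |x 1| ^ (l + 2) := by
  obtain ⟨D, hD, h⟩ := rce_step1 G σ hG hσ hσ1 (l + 2)
  refine ⟨2 * D, by positivity, fun x hx => ?_⟩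
  obtain ⟨hj, hl⟩ := h x hx
  obtain ⟨hs, hS, -⟩ := hx
  have hsm := (rce_tail hs l (∑' k : ℕ, |x (k + 1)|)
    (fun i hi => rce_le_tsum hs i (by omega))).1
  rw [hsm.tsum_eq_zero_add]
  have hs' : Summable fun k : ℕ => |x (k + 1 + 1)| := (summable_nat_add_iff 1).2 hs
  have t1 : ∑' k : ℕ, |x (k + 1 + 1)| ≤ 1 := by
    have := hs.tsum_eq_zero_add
    have := abs_nonneg (x (0 + 1))
    linarith
  have t2 : ∑' k : ℕ, |x (l + (k + 1) + 1)| * |x (k + 1 + 1)| ≤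
      ∑' k : ℕ, D * |x 1| ^ (l + 2) * |x (k + 1 + 1)| := by
    refine Summable.tsum_le_tsum (fun k => ?_) ((summable_nat_add_iff 1).2 hsm) (hs'.mul_left _)
    exact mul_le_mul_of_nonneg_right (hl _ (by omega) (by omega)) (abs_nonneg _)
  rw [tsum_mul_left] at t2
  have t3 : D * |x 1| ^ (l + 2) * ∑' k : ℕ, |x (k + 1 + 1)| ≤ D * |x 1| ^ (l + 2) * 1 := by
    gcongr
  have t4 : |x (l + 0 + 1)| * |x (0 + 1)| ≤ D * |x 1| ^ (l + 1) * |x 1| := by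
    refine mul_le_mul_of_nonneg_right (hj (l + 1) (by omega) (by omega)) (abs_nonneg _)
  have t5 : D * |x 1| ^ (l + 1) * |x 1| = D * |x 1| ^ (l + 2) := by ring
  linarith

/-- The recursion. -/
def rceZ (b : ℕ → ℝ) (κ : ℝ) : ℕ → ℝ
  | 0 => 0
  | 1 => 1
  | (n + 2) => κ / (((n + 2 : ℕ) : ℝ) * (2 - κ * b (n + 2)))
      * ∑ j : Finset.Ico 1 (n + 2), ((j : ℕ) : ℝ) * b j * rceZ b κ j * rceZ b κ (n + 2 - j)
  decreasing_by
    all_goals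
      have := Finset.mem_Ico.1 j.2
      omega

lemma rceZ_one (b : ℕ → ℝ) (κ : ℝ) : rceZ b κ 1 = 1 := by
  rw [rceZ]

lemma rceZ_rec (b : ℕ → ℝ) (κ : ℝ) (ℓ : ℕ) (h : 2 ≤ ℓ) :
    rceZ b κ ℓ = κ / ((ℓ : ℝ) * (2 - κ * b ℓ))
      * ∑ j ∈ Finset.Ico 1 ℓ, (j : ℝ) * b j * rceZ b κ j * rceZ b κ (ℓ - j) := by
  obtain ⟨n, rfl⟩ : ∃ n, ℓ = n + 2 := ⟨ℓ - 2, by omega⟩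
  rw [rceZ]
  congr 1
  exact Finset.sum_coe_sort (Finset.Ico 1 (n + 2))
    (fun j => (j : ℝ) * b j * rceZ b κ j * rceZ b κ (n + 2 - j))

lemma rce_gap (b : ℕ → ℝ) (hsum : Summable fun ℓ : ℕ => |b (ℓ + 1)|)
    (h1 : 0 < b 1) (hne : ∀ ℓ : ℕ, 2 ≤ ℓ → b ℓ ≠ b 1) :
    ∃ c : ℝ, 0 < c ∧ ∀ ℓ, 2 ≤ ℓ → c ≤ |b 1 - b ℓ| := by
  have ht := hsum.tendsto_atTop_zero
  obtain ⟨n, hn⟩ := (ht.eventually (gt_mem_nhds (half_pos h1))).exists_forall_of_atTop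
  have fin : ∀ n : ℕ, ∃ c : ℝ, 0 < c ∧ ∀ ℓ, 2 ≤ ℓ → ℓ ≤ n → c ≤ |b 1 - b ℓ| := by
    intro n
    induction n with
    | zero => exact ⟨1, one_pos, fun l h2 h => by omega⟩
    | succ n ih =>
      obtain ⟨c, hc, h⟩ := ih
      by_cases h2 : 2 ≤ n + 1
      · refine ⟨min c |b 1 - b (n + 1)|, lt_min hc
          (abs_pos.2 (sub_ne_zero.2 (hne _ h2).symm)), fun l hl hl' => ?_⟩
        rcases Nat.lt_or_ge l (n + 1) with h3 | h3
        · exact (min_le_left _ _).trans (h l hl (by omega))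
        · obtain rfl : l = n + 1 := by omega
          exact min_le_right _ _
      · exact ⟨c, hc, fun l hl hl' => by omega⟩
  obtain ⟨c, hc, h⟩ := fin n
  refine ⟨min c (b 1 / 2), lt_min hc (half_pos h1), fun l hl => ?_⟩
  rcases Nat.lt_or_ge n l with h3 | h3
  · have := hn (l - 1) (by omega)
    rw [Nat.sub_add_cancel (by omega)] at this
    have h4 := abs_sub_abs_le_abs_sub (b 1) (b l)
    rw [abs_of_pos h1] at h4
    exact (min_le_right _ _).trans (by linarith)
  · exact (min_le_left _ _).trans (h l hl h3)

/-- `ℓ¹` norm bounded by weighted norm. -/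
lemma rce_l1 : ∃ K : ℝ, 0 < K ∧ ∀ η : ℝ, 0 < η → ∀ x : ℕ → ℝ, MemL2w x → wnorm x ≤ η →
    (Summable fun k : ℕ => |x (k + 1)|) ∧ ∑' k : ℕ, |x (k + 1)| ≤ η * K := by
  have hw : Summable fun k : ℕ => (1 + ((k + 1 : ℕ) : ℝ) ^ 2)⁻¹ := by
    have h := (summable_nat_add_iff 1).2 (Real.summable_nat_pow_inv.2 (by norm_num : 1 < 2))
    refine Summable.of_nonneg_of_le (fun k => by positivity) (fun k => ?_) h
    exact inv_anti₀ (by positivity) (by linarith)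
  have hW : 0 ≤ ∑' k : ℕ, (1 + ((k + 1 : ℕ) : ℝ) ^ 2)⁻¹ := tsum_nonneg fun k => by positivity
  refine ⟨(∑' k : ℕ, (1 + ((k + 1 : ℕ) : ℝ) ^ 2)⁻¹) + 1, by linarith, ?_⟩
  intro η hη x hx hn
  have hle : ∀ k : ℕ, |x (k + 1)| ≤ η * (1 + ((k + 1 : ℕ) : ℝ) ^ 2)⁻¹
      + η⁻¹ * ((1 + ((k + 1 : ℕ) : ℝ) ^ 2) * x (k + 1) ^ 2) := by
    intro k
    set w := 1 + ((k + 1 : ℕ) : ℝ) ^ 2 with hw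
    have hw0 : 0 < w := by positivity
    have e : η * w⁻¹ + η⁻¹ * (w * x (k + 1) ^ 2) - |x (k + 1)| =
        η⁻¹ * w⁻¹ * ((η - w * |x (k + 1)|) ^ 2 + η * w * |x (k + 1)|) := by
      rw [← sq_abs (x (k + 1))]
      field_simp
      ring
    have : 0 ≤ η⁻¹ * w⁻¹ * ((η - w * |x (k + 1)|) ^ 2 + η * w * |x (k + 1)|) := by positivity
    linarith
  have hsm := (hw.mul_left η).add ((show Summable _ from hx).mul_left η⁻¹)
  have hs : Summable fun k : ℕ => |x (k + 1)| :=
    Summable.of_nonneg_of_le (fun k => abs_nonneg _) hle hsm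
  refine ⟨hs, ?_⟩
  have h := hs.tsum_le_tsum hle hsm
  rw [Summable.tsum_add (hw.mul_left η) ((show Summable _ from hx).mul_left η⁻¹),
    tsum_mul_left, tsum_mul_left] at h
  have h2 : wnormSq x ≤ η ^ 2 := by
    unfold wnorm at hn
    exact (Real.sqrt_le_left hη.le).1 hn
  have h3 : η⁻¹ * wnormSq x ≤ η⁻¹ * η ^ 2 := by gcongr
  have h4 : η⁻¹ * η ^ 2 = η := by field_simp
  unfold wnormSq at h3
  linarith

/-- Bound of the infinite sum in the system. -/
lemma rce_tsum_bound (b : ℕ → ℝ) (B : ℝ) (hB : ∀ ℓ : ℕ, 1 ≤ ℓ → (ℓ : ℝ) * |b ℓ| ≤ B)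
    (x : ℕ → ℝ) (hs : Summable fun k : ℕ => |x (k + 1)|) (ℓ : ℕ) :
    |∑' k : ℕ, (((ℓ + k + 1 : ℕ) : ℝ) * b (ℓ + k + 1) - ((k + 1 : ℕ) : ℝ) * b (k + 1))
        * x (ℓ + k + 1) * x (k + 1)| ≤ 2 * B * ∑' k : ℕ, |x (ℓ + k + 1)| * |x (k + 1)| := by
  have hsm := (rce_tail hs ℓ (∑' k : ℕ, |x (k + 1)|)
    (fun i hi => rce_le_tsum hs i (by omega))).1
  rw [← tsum_mul_left, ← Real.norm_eq_abs]
  refine tsum_of_norm_bounded (hsm.mul_left (2 * B)).hasSum (fun k => ?_)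
  rw [Real.norm_eq_abs, abs_mul, abs_mul, mul_assoc]
  refine mul_le_mul_of_nonneg_right ?_ (by positivity)
  refine (abs_sub _ _).trans ?_
  rw [abs_mul, abs_mul, Nat.abs_cast, Nat.abs_cast]
  linarith [hB (ℓ + k + 1) (by omega), hB (k + 1) (by omega)]

lemma rce_good (b : ℕ → ℝ) (B M c : ℝ) (hB : ∀ ℓ : ℕ, 1 ≤ ℓ → (ℓ : ℝ) * |b ℓ| ≤ B)
    (hB0 : 0 ≤ B) (hc : 0 < c) (κ : ℝ) (hκ : 0 ≤ κ) (hκM : κ ≤ M)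
    (hgap : ∀ ℓ : ℕ, 2 ≤ ℓ → c ≤ |(ℓ : ℝ) * (2 - κ * b ℓ)|) (σ : ℝ) (x : ℕ → ℝ)
    (hs : Summable fun k : ℕ => |x (k + 1)|) (hS : ∑' k : ℕ, |x (k + 1)| ≤ σ)
    (hx : SolvesMV b κ x) : RCEGood (2 * M * B / c) σ x := by
  refine ⟨hs, hS, fun ℓ hl => ?_⟩
  have heq := (hx ℓ (by omega)).2
  have h1 := rce_tsum_bound b B hB x hs ℓ
  have h2 : |∑ j ∈ Finset.Ico 1 ℓ, (j : ℝ) * b j * x j * x (ℓ - j)| ≤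
      B * ∑ j ∈ Finset.Ico 1 ℓ, |x j| * |x (ℓ - j)| := by
    refine (Finset.abs_sum_le_sum_abs _ _).trans ?_
    rw [Finset.mul_sum]
    refine Finset.sum_le_sum fun j hj => ?_
    rw [abs_mul, abs_mul, abs_mul, Nat.abs_cast, mul_assoc]
    exact mul_le_mul_of_nonneg_right (hB j (Finset.mem_Ico.1 hj).1) (by positivity)
  have h3 : c * |x ℓ| ≤ |(ℓ : ℝ) * (2 - κ * b ℓ) * x ℓ| := by
    rw [abs_mul]
    exact mul_le_mul_of_nonneg_right (hgap ℓ hl) (abs_nonneg _)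
  rw [heq, ← mul_add, abs_mul, abs_of_nonneg hκ] at h3
  set P := ∑ j ∈ Finset.Ico 1 ℓ, |x j| * |x (ℓ - j)|
  set Q := ∑' k : ℕ, |x (ℓ + k + 1)| * |x (k + 1)|
  have hP : 0 ≤ P := Finset.sum_nonneg fun j _ => by positivity
  have h4 := (abs_add_le (∑ j ∈ Finset.Ico 1 ℓ, (j : ℝ) * b j * x j * x (ℓ - j))
    (∑' k : ℕ, (((ℓ + k + 1 : ℕ) : ℝ) * b (ℓ + k + 1) - ((k + 1 : ℕ) : ℝ) * b (k + 1))
        * x (ℓ + k + 1) * x (k + 1)))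
  have h5 : c * |x ℓ| ≤ M * (2 * B * (P + Q)) := by
    refine h3.trans (mul_le_mul hκM (h4.trans ?_) (abs_nonneg _) (hκ.trans hκM))
    nlinarith [mul_nonneg hB0 hP]
  have h6 : 2 * M * B / c * (P + Q) = (M * (2 * B * (P + Q))) / c := by ring
  rw [h6, le_div_iff₀ hc]
  linarith

lemma rce_step2 (b : ℕ → ℝ) (B M c σ : ℝ) (hB : ∀ ℓ : ℕ, 1 ≤ ℓ → (ℓ : ℝ) * |b ℓ| ≤ B)
    (hB0 : 0 ≤ B) (hc : 0 < c) (hM : 0 ≤ M) (hσ : 3 * (2 * M * B / c) * σ ≤ 1 / 2) (hσ1 : σ ≤ 1)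
    (n : ℕ) : ∃ C : ℝ, 0 < C ∧ ∀ κ : ℝ, 0 ≤ κ → κ ≤ M →
      (∀ ℓ : ℕ, 2 ≤ ℓ → c ≤ |(ℓ : ℝ) * (2 - κ * b ℓ)|) → ∀ j, 1 ≤ j → j ≤ n →
      |rceZ b κ j| ≤ C ∧ ∀ x : ℕ → ℝ, RCEGood (2 * M * B / c) σ x → SolvesMV b κ x →
        |x j - x 1 ^ j * rceZ b κ j| ≤ C * |x 1| ^ (j + 2) := by
  have hG : 0 ≤ 2 * M * B / c := by positivity
  induction n with
  | zero => exact ⟨1, one_pos, fun κ _ _ _ j _ _ => by omega⟩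
  | succ l ih =>
    obtain ⟨C, hC, ih⟩ := ih
    rcases Nat.eq_zero_or_pos l with rfl | hl0
    · refine ⟨1, one_pos, fun κ _ _ _ j h1 h2 => ?_⟩
      obtain rfl : j = 1 := by omega
      rw [rceZ_one]
      refine ⟨by simp, fun x _ _ => ?_⟩
      simp
    obtain ⟨D, hD, hDx⟩ := rce_step1 _ σ hG hσ hσ1 (l + 1)
    obtain ⟨T, hT, hTx⟩ := rce_tail2 _ σ hG hσ hσ1 (l + 1)
    obtain ⟨n, hn⟩ : ∃ n, n = l + 1 := ⟨_, rfl⟩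
    rw [← hn] at hDx hTx ⊢
    set C1 := M / c * (n * (B * C * C)) with hC1
    set C2 := M / c * (n * (B * (C * D + C * C)) + 2 * B * T) with hC2
    have hC1' : 0 ≤ C1 := by positivity
    have hC2' : 0 ≤ C2 := by positivity
    have hcard : ((Finset.Ico 1 n).card : ℝ) ≤ n := by
      rw [Nat.card_Ico]; exact_mod_cast Nat.sub_le _ _
    refine ⟨C + C1 + C2, by positivity, fun κ hκ hκM hgap j hj1 hjn => ?_⟩
    have ih' := ih κ hκ hκM hgap
    rcases Nat.lt_or_ge j n with hlt | hge
    · obtain ⟨a1, a2⟩ := ih' j hj1 (by omega)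
      refine ⟨by linarith, fun x hg hx => (a2 x hg hx).trans ?_⟩
      gcongr
      linarith
    obtain rfl : j = n := by omega
    rename ℕ => j
    have hn2 : 2 ≤ j := by omega
    have hgapn := hgap j hn2
    have hz : ∀ i, 1 ≤ i → i < j → |rceZ b κ i| ≤ C := fun i h1 h2 => (ih' i h1 (by omega)).1
    have hne : (j : ℝ) * (2 - κ * b j) ≠ 0 := by
      intro h; rw [h, abs_zero] at hgapn; linarith
    have hrat : |κ / ((j : ℝ) * (2 - κ * b j))| ≤ M / c := by
      rw [abs_div, abs_of_nonneg hκ]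
      exact div_le_div₀ hM hκM hc hgapn
    constructor
    · have : |rceZ b κ j| ≤ C1 := by
        rw [rceZ_rec b κ j hn2, abs_mul]
        refine mul_le_mul hrat ?_ (abs_nonneg _) (by positivity)
        refine (Finset.abs_sum_le_sum_abs _ _).trans ?_
        refine (Finset.sum_le_card_nsmul _ _ (B * C * C) fun i hi => ?_).trans ?_
        · rw [Finset.mem_Ico] at hi
          rw [abs_mul, abs_mul, abs_mul, Nat.abs_cast]
          have := hB i hi.1
          have := hz i hi.1 hi.2
          have := hz (j - i) (by omega) (by omega)
          gcongr
        · rw [nsmul_eq_mul]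
          gcongr
      linarith
    · intro x hg hx
      obtain ⟨hDj, -⟩ := hDx x hg
      have hTj := hTx x hg
      set y := |x 1| with hy
      have hy0 : 0 ≤ y := abs_nonneg _
      have heq := (hx j hj1).2
      have htail := rce_tsum_bound b B hB x hg.1 j
      set W := ∑' k : ℕ, (((j + k + 1 : ℕ) : ℝ) * b (j + k + 1) - ((k + 1 : ℕ) : ℝ) * b (k + 1))
        * x (j + k + 1) * x (k + 1) with hW
      have hxj : x j = κ / ((j : ℝ) * (2 - κ * b j)) *
          (∑ i ∈ Finset.Ico 1 j, (i : ℝ) * b i * x i * x (j - i) + W) := by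
        rw [div_mul_eq_mul_div, eq_div_iff hne]
        linarith
      have hdiff : x j - x 1 ^ j * rceZ b κ j = κ / ((j : ℝ) * (2 - κ * b j)) *
          (∑ i ∈ Finset.Ico 1 j, (i : ℝ) * b i *
            ((x i - x 1 ^ i * rceZ b κ i) * x (j - i) +
              x 1 ^ i * rceZ b κ i * (x (j - i) - x 1 ^ (j - i) * rceZ b κ (j - i))) + W) := by
        rw [hxj, rceZ_rec b κ j hn2, mul_left_comm, ← mul_sub]
        congr 1
        rw [add_sub_right_comm, Finset.mul_sum, ← Finset.sum_sub_distrib]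
        congr 1
        refine Finset.sum_congr rfl fun i hi => ?_
        rw [Finset.mem_Ico] at hi
        have : x 1 ^ j = x 1 ^ i * x 1 ^ (j - i) := by rw [← pow_add]; congr 1; omega
        rw [this]; ring
      have hmain : |x j - x 1 ^ j * rceZ b κ j| ≤ C2 * y ^ (j + 2) := by
        rw [hdiff, abs_mul, hC2, mul_assoc]
        refine mul_le_mul hrat ?_ (abs_nonneg _) (by positivity)
        refine (abs_add_le _ _).trans ?_
        rw [add_mul]
        refine add_le_add ?_ ?_
        · refine (Finset.abs_sum_le_sum_abs _ _).trans ?_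
          refine (Finset.sum_le_card_nsmul _ _ (B * (C * D + C * C) * y ^ (j + 2))
            fun i hi => ?_).trans ?_
          · rw [Finset.mem_Ico] at hi
            rw [abs_mul, abs_mul, Nat.abs_cast, mul_assoc B]
            refine mul_le_mul (hB i hi.1) ?_ (abs_nonneg _) hB0
            refine (abs_add_le _ _).trans ?_
            rw [add_mul, abs_mul, abs_mul, abs_mul, abs_pow]
            have e1 : |x i - x 1 ^ i * rceZ b κ i| ≤ C * y ^ (i + 2) :=
              (ih' i hi.1 (by omega)).2 x hg hx
            have e2 : |x (j - i) - x 1 ^ (j - i) * rceZ b κ (j - i)| ≤ C * y ^ (j - i + 2) :=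
              (ih' (j - i) (by omega) (by omega)).2 x hg hx
            have e3 : |x (j - i)| ≤ D * y ^ (j - i) := hDj (j - i) (by omega) (by omega)
            have e4 := hz i hi.1 hi.2
            have p : y ^ (j + 2) = y ^ i * y ^ (j - i) * y ^ 2 := by
              rw [← pow_add, ← pow_add]; congr 1; omega
            refine add_le_add ?_ ?_
            · calc _ ≤ (C * y ^ (i + 2)) * (D * y ^ (j - i)) :=
                    mul_le_mul e1 e3 (abs_nonneg _) (by positivity)
                _ = _ := by rw [p]; ring
            · calc _ ≤ (y ^ i * C) * (C * y ^ (j - i + 2)) :=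
                    mul_le_mul (mul_le_mul_of_nonneg_left e4 (by positivity)) e2 (abs_nonneg _)
                      (by positivity)
                _ = _ := by rw [p]; ring
          · rw [nsmul_eq_mul, mul_assoc (j : ℝ)]
            gcongr
        · refine htail.trans ?_
          rw [mul_assoc (2 * B)]
          gcongr
      have : 0 ≤ (C + C1) * y ^ (j + 2) := by positivity
      linarith

/-- the recursive coefficients `z_ℓ(κ)` are well defined on an interval
`I = [2/b₁ − δ, 2/b₁ + δ]` and every small solution `x` of the Fourier system with
coefficients `b` satisfies `|x_ℓ − x₁^ℓ z_ℓ(κ)| ≤ C_ℓ |x₁|^{ℓ+2}`. -/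
theorem recursive_coefficient_expansion
    (b : ℕ → ℝ) (hA : ∃ C : ℝ, ∀ ℓ : ℕ, 1 ≤ ℓ → (ℓ : ℝ) * |b ℓ| ≤ C)
    (hsum : Summable fun ℓ : ℕ => |b (ℓ + 1)|)
    (h1 : 0 < b 1) (hne : ∀ ℓ : ℕ, 2 ≤ ℓ → b ℓ ≠ b 1) :
    ∃ δ : ℝ, 0 < δ ∧ δ < 2 / b 1 ∧ ∃ η : ℝ, 0 < η ∧
      ∃ Cf : ℕ → ℝ, (∀ ℓ : ℕ, 1 ≤ ℓ → 0 < Cf ℓ) ∧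
      (∀ κ : ℝ, 2 / b 1 - δ ≤ κ → κ ≤ 2 / b 1 + δ →
        ∀ ℓ : ℕ, 2 ≤ ℓ → 2 - κ * b ℓ ≠ 0) ∧
      ∃ z : ℝ → ℕ → ℝ,
        (∀ κ : ℝ, 2 / b 1 - δ ≤ κ → κ ≤ 2 / b 1 + δ →
          z κ 1 = 1 ∧
          ∀ ℓ : ℕ, 2 ≤ ℓ →
            z κ ℓ = κ / ((ℓ : ℝ) * (2 - κ * b ℓ))
              * ∑ j ∈ Finset.Ico 1 ℓ, (j : ℝ) * b j * z κ j * z κ (ℓ - j)) ∧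
        ∀ κ : ℝ, 2 / b 1 - δ ≤ κ → κ ≤ 2 / b 1 + δ →
          ∀ x : ℕ → ℝ, MemL2w x → wnorm x ≤ η → SolvesMV b κ x →
            ∀ ℓ : ℕ, 1 ≤ ℓ →
              |x ℓ - x 1 ^ ℓ * z κ ℓ| ≤ Cf ℓ * |x 1| ^ (ℓ + 2) := by
  obtain ⟨B, hB⟩ := hA
  have hB0 : 0 < B := by
    have := hB 1 le_rfl
    rw [Nat.cast_one, one_mul, abs_of_pos h1] at this
    linarith
  obtain ⟨c, hc, hgap⟩ := rce_gap b hsum h1 hne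
  have hbB : ∀ ℓ : ℕ, 1 ≤ ℓ → |b ℓ| ≤ B := fun ℓ hl => by
    refine le_trans ?_ (hB ℓ hl)
    exact le_mul_of_one_le_left (abs_nonneg _) (by exact_mod_cast hl)
  obtain ⟨K, hK, hl1⟩ := rce_l1
  have hq : 0 < 2 / b 1 := by positivity
  set c' := 2 / b 1 * c / 2 with hc'
  have hc'0 : 0 < c' := by positivity
  set δ := min (2 / b 1 / 2) (c' / B) with hδ
  have hδ0 : 0 < δ := lt_min (by positivity) (by positivity)
  have hδ1 : δ ≤ 2 / b 1 / 2 := min_le_left _ _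
  have hδ2 : δ * B ≤ c' := by
    have := min_le_right (2 / b 1 / 2) (c' / B)
    rwa [← hδ, le_div_iff₀ hB0] at this
  set M := 2 / b 1 + δ with hM
  have hM0 : 0 < M := by positivity
  set G := 2 * M * B / c' with hG
  have hG0 : 0 < G := by positivity
  set σ := min 1 (1 / (6 * G)) with hσ
  have hσ0 : 0 < σ := lt_min one_pos (by positivity)
  have hσ1 : σ ≤ 1 := min_le_left _ _
  have hσ2 : 3 * G * σ ≤ 1 / 2 := by
    have := min_le_right 1 (1 / (6 * G))
    rw [← hσ, le_div_iff₀ (by positivity)] at this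
    linarith
  have hgapκ : ∀ κ : ℝ, 2 / b 1 - δ ≤ κ → κ ≤ 2 / b 1 + δ → ∀ ℓ : ℕ, 2 ≤ ℓ →
      c' ≤ |2 - κ * b ℓ| := by
    intro κ k1 k2 ℓ hl
    have e : 2 - κ * b ℓ = 2 / b 1 * (b 1 - b ℓ) - (κ - 2 / b 1) * b ℓ := by
      field_simp
      ring
    have e1 := abs_sub_abs_le_abs_sub (2 / b 1 * (b 1 - b ℓ)) ((κ - 2 / b 1) * b ℓ)
    rw [← e, abs_mul, abs_mul, abs_of_pos hq] at e1
    have e2 : 2 / b 1 * c ≤ 2 / b 1 * |b 1 - b ℓ| := by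
      have := hgap ℓ hl
      gcongr
    have e3 : |κ - 2 / b 1| * |b ℓ| ≤ δ * B :=
      mul_le_mul (abs_le.2 ⟨by linarith, by linarith⟩) (hbB ℓ (by omega)) (abs_nonneg _) hδ0.le
    linarith
  have hgap2 : ∀ κ : ℝ, 2 / b 1 - δ ≤ κ → κ ≤ 2 / b 1 + δ → ∀ ℓ : ℕ, 2 ≤ ℓ →
      c' ≤ |(ℓ : ℝ) * (2 - κ * b ℓ)| := by
    intro κ k1 k2 ℓ hl
    rw [abs_mul, Nat.abs_cast]
    refine (hgapκ κ k1 k2 ℓ hl).trans (le_mul_of_one_le_left (abs_nonneg _) ?_)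
    exact_mod_cast (by omega : 1 ≤ ℓ)
  choose Cf hCf hCf2 using rce_step2 b B M c' σ hB hB0.le hc'0 hM0.le hσ2 hσ1
  refine ⟨δ, hδ0, by linarith, σ / K, by positivity, Cf, fun ℓ _ => hCf ℓ, ?_, rceZ b, ?_, ?_⟩
  · intro κ k1 k2 ℓ hl h
    have := hgapκ κ k1 k2 ℓ hl
    rw [h, abs_zero] at this
    linarith
  · intro κ k1 k2
    exact ⟨rceZ_one b κ, fun ℓ hl => rceZ_rec b κ ℓ hl⟩
  · intro κ k1 k2 x hx hn hsol ℓ hl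
    obtain ⟨hs, hS⟩ := hl1 (σ / K) (by positivity) x hx hn
    rw [div_mul_cancel₀ _ hK.ne'] at hS
    have hκ : 0 ≤ κ := by linarith
    have hg := rce_good b B M c' hB hB0.le hc'0 κ hκ k2 (hgap2 κ k1 k2) σ x hs hS hsol
    exact (hCf2 ℓ κ hκ k2 (hgap2 κ k1 k2) ℓ hl le_rfl).2 x hg hsol
end
end
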